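/- arXiv:1707.01551 — 2 statements merged into one kernel-verified Lean document; each statement's English description precedes it below -/
import Mathlib

section
/- (Higman's inequality) In a finite generalised quadrangle of order (s,t) with s > 1 and t > 1, one has s ≤ t² and t ≤ s². -/
/-- A generalised quadrangle: an incidence structure on points `P` and lines `L`
such that two distinct points lie on at most one common line, and the GQ axiom
holds: for every point `x` and line `l` not through `x`, there is exactly one
point on `l` collinear with `x`. -/
structure GenQuad (P L : Type*) where
  incid : P → L → Prop
  unique_line : ∀ ⦃p q : P⦄, p ≠ q → ∀ ⦃l m : L⦄,
    incid p l → incid q l → incid p m → incid q m → l = m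
  gq : ∀ (x : P) (l : L), ¬ incid x l →
    ∃! y : P, incid y l ∧ ∃ m : L, incid x m ∧ incid y m

/-- Two points are collinear if some line is incident with both. -/
def GenQuad.Collin {P L : Type*} (G : GenQuad P L) (x y : P) : Prop :=
  ∃ l : L, G.incid x l ∧ G.incid y l

namespace GenQuad

/-- The dual generalised quadrangle, with points and lines interchanged. -/
def dual {P L : Type*} (G : GenQuad P L) : GenQuad L P where
  incid l p := G.incid p l
  unique_line := by
    intro l m hlm p q hpl hpm hql hqm
    by_contra hpq
    exact hlm (G.unique_line hpq hpl hql hpm hqm)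
  gq := by
    intro l x hxl
    obtain ⟨y, ⟨hyl, m, hxm, hym⟩, huniq⟩ := G.gq x l hxl
    refine ⟨m, ⟨hxm, y, hyl, hym⟩, ?_⟩
    rintro m' ⟨hxm', y', hyl', hym'⟩
    obtain rfl := huniq y' ⟨hyl', m', hxm', hym'⟩
    have hxy : x ≠ y' := by
      rintro rfl
      exact hxl hyl
    exact G.unique_line hxy hxm' hym' hxm hym

section Collinearity

variable {P L : Type*} (G : GenQuad P L)

theorem collin_symm {G : GenQuad P L} {x y : P} (h : G.Collin x y) : G.Collin y x :=
  h.imp fun _ hl => hl.symm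

/-- A point off a line is collinear with at most one point of the line. -/
theorem eq_of_collin_of_not_incid {x u v : P} {l : L} (hx : ¬ G.incid x l)
    (hu : G.incid u l) (hv : G.incid v l) (hxu : G.Collin x u) (hxv : G.Collin x v) :
    u = v :=
  (G.gq x l hx).unique ⟨hu, hxu⟩ ⟨hv, hxv⟩

/-- Distinct common neighbours of two noncollinear points are noncollinear. -/
theorem not_collin_of_common {x y u v : P} (hxy : ¬ G.Collin x y) (huv : u ≠ v)
    (hxu : G.Collin x u) (hxv : G.Collin x v) (hyu : G.Collin y u) (hyv : G.Collin y v) :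
    ¬ G.Collin u v := by
  rintro ⟨l, hul, hvl⟩
  by_cases hx : G.incid x l
  · by_cases hy : G.incid y l
    · exact hxy ⟨l, hx, hy⟩
    · exact huv (G.eq_of_collin_of_not_incid hy hul hvl hyu hyv)
  · exact huv (G.eq_of_collin_of_not_incid hx hul hvl hxu hxv)

end Collinearity

section Counting

open Finset
open scoped Classical

variable {P L : Type*} (G : GenQuad P L) {s t : ℕ}

theorem collin_self [Fintype L] (hpoint : ∀ p : P, #{l : L | G.incid p l} = t + 1) (x : P) :
    G.Collin x x := by
  have : 0 < #{l : L | G.incid x l} := by rw [hpoint]; omega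
  obtain ⟨l, hl⟩ := card_pos.mp this
  have hl' : G.incid x l := by simpa using hl
  exact ⟨l, hl', hl'⟩

variable [Fintype P]

/-- The lines of a set `S` of lines through `u` cover `s * #S` points other than `u`. -/
theorem card_points_on (hline : ∀ l : L, #{p : P | G.incid p l} = s + 1) (u : P)
    (S : Finset L) (hS : ∀ l ∈ S, G.incid u l) :
    #{z : P | z ≠ u ∧ ∃ l ∈ S, G.incid z l} = s * #S := by
  have heq : ({z : P | z ≠ u ∧ ∃ l ∈ S, G.incid z l} : Finset P) =
      S.biUnion fun l => ({z : P | G.incid z l} : Finset P).erase u := by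
    ext z
    simp only [mem_filter, mem_univ, true_and, mem_biUnion, mem_erase]
    tauto
  rw [heq, card_biUnion]
  · rw [sum_congr rfl (g := fun _ => s), sum_const, smul_eq_mul, mul_comm]
    intro l hl
    rw [card_erase_of_mem (by simpa using hS l hl), hline, Nat.add_sub_cancel]
  · intro l hl m hm hlm
    rw [Function.onFun, disjoint_left]
    intro z hz hz'
    simp only [mem_filter, mem_univ, true_and, mem_erase] at hz hz'
    exact hlm (G.unique_line hz.1 hz.2 (hS l hl) hz'.2 (hS m hm))

variable [Fintype L]

/-- Two noncollinear points have `t + 1` common neighbours. -/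
theorem card_common (hpoint : ∀ p : P, #{l : L | G.incid p l} = t + 1) {x y : P}
    (hxy : ¬ G.Collin x y) : #{z : P | G.Collin x z ∧ G.Collin y z} = t + 1 := by
  rw [← hpoint y]
  have hoff : ∀ l : L, G.incid y l → ¬ G.incid x l := fun l hy hx => hxy ⟨l, hx, hy⟩
  symm
  refine Finset.card_bij
    (fun l hl => (G.gq x l (hoff l (by simpa using hl))).choose) ?_ ?_ ?_
  · intro l hl
    have hl' : G.incid y l := by simpa using hl
    have h := (G.gq x l (hoff l hl')).choose_spec.1
    simp only [mem_filter, mem_univ, true_and]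
    exact ⟨h.2, l, hl', h.1⟩
  · intro l hl m hm heq
    have hl' : G.incid y l := by simpa using hl
    have hm' : G.incid y m := by simpa using hm
    have h := (G.gq x l (hoff l hl')).choose_spec.1
    have h' := (G.gq x m (hoff m hm')).choose_spec.1
    dsimp only at heq
    rw [← heq] at h'
    refine G.unique_line (fun hyz => hxy ?_) hl' h.1 hm' h'.1
    rw [hyz]
    exact h.2
  · intro z hz
    simp only [mem_filter, mem_univ, true_and] at hz
    obtain ⟨hxz, l, hyl, hzl⟩ := hz
    refine ⟨l, by simpa using hyl, ?_⟩
    exact ((G.gq x l (hoff l hyl)).choose_spec.2 z ⟨hzl, hxz⟩).symm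

theorem card_collin (hline : ∀ l : L, #{p : P | G.incid p l} = s + 1)
    (hpoint : ∀ p : P, #{l : L | G.incid p l} = t + 1) (x : P) :
    #{z : P | G.Collin x z} = s * (t + 1) + 1 := by
  have h := G.card_points_on hline x {l : L | G.incid x l} (by simp)
  rw [hpoint] at h
  rw [← h, ← card_erase_add_one (a := x) (by simpa using G.collin_self hpoint x)]
  congr 2
  ext z
  simp only [mem_erase, mem_filter, mem_univ, true_and]
  rfl

/-- A neighbour `w ≠ x` of `x` is collinear with `s * t` points not collinear with `x`. -/
theorem card_collin_not_collin (hline : ∀ l : L, #{p : P | G.incid p l} = s + 1)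
    (hpoint : ∀ p : P, #{l : L | G.incid p l} = t + 1) {x w : P} (hwx : w ≠ x)
    (hxw : G.Collin x w) :
    #{z : P | G.Collin w z ∧ ¬ G.Collin x z} = s * t := by
  obtain ⟨m, hxm, hwm⟩ := hxw
  have h := G.card_points_on hline w (({l : L | G.incid w l} : Finset L).erase m)
    (by simp)
  rw [card_erase_of_mem (by simpa using hwm), hpoint, Nat.add_sub_cancel] at h
  rw [← h]
  congr 1
  ext z
  simp only [mem_filter, mem_univ, true_and, mem_erase]
  constructor
  · rintro ⟨⟨l, hwl, hzl⟩, hxz⟩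
    refine ⟨?_, l, ⟨?_, hwl⟩, hzl⟩
    · rintro rfl
      exact hxz ⟨m, hxm, hwm⟩
    · rintro rfl
      exact hxz ⟨l, hxm, hzl⟩
  · rintro ⟨hzw, l, ⟨hlm, hwl⟩, hzl⟩
    refine ⟨⟨l, hwl, hzl⟩, fun hxz => hzw ?_⟩
    refine G.eq_of_collin_of_not_incid (fun hxl => hlm ?_) hzl hwl hxz ⟨m, hxm, hwm⟩
    exact G.unique_line hwx hwl hxl hwm hxm

theorem card_not_collin (hline : ∀ l : L, #{p : P | G.incid p l} = s + 1)
    (hpoint : ∀ p : P, #{l : L | G.incid p l} = t + 1) (x : P) :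
    #{z : P | ¬ G.Collin x z} = s ^ 2 * t := by
  have h := sum_card_bipartiteAbove_eq_sum_card_bipartiteBelow
    (s := ({z : P | ¬ G.Collin x z} : Finset P))
    (t := ({w : P | G.Collin x w} : Finset P).erase x) (r := fun z w => G.Collin w z)
  rw [sum_congr rfl (g := fun _ => t + 1), sum_const, sum_congr rfl (g := fun _ => s * t),
    sum_const, smul_eq_mul, smul_eq_mul, card_erase_of_mem, G.card_collin hline hpoint,
    Nat.add_sub_cancel] at h
  · have ht : 0 < t + 1 := by omega
    apply Nat.eq_of_mul_eq_mul_right ht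
    rw [h]
    ring
  · simpa using G.collin_self hpoint x
  · intro w hw
    simp only [mem_filter, mem_univ, true_and, mem_erase] at hw
    rw [← G.card_collin_not_collin hline hpoint hw.1 hw.2]
    congr 1
    ext z
    simp [bipartiteBelow, and_comm]
  · intro z hz
    simp only [mem_filter, mem_univ, true_and] at hz
    rw [← G.card_common hpoint hz]
    congr 1
    ext w
    simp only [bipartiteAbove, mem_filter, mem_univ, true_and, mem_erase]
    constructor
    · rintro ⟨⟨-, hxw⟩, hwz⟩
      exact ⟨hxw, collin_symm hwz⟩
    · rintro ⟨hxw, hzw⟩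
      refine ⟨⟨?_, hxw⟩, collin_symm hzw⟩
      rintro rfl
      exact hz (collin_symm hzw)

/-- The number of points collinear with neither of two noncollinear points. -/
theorem card_not_collin_both (hline : ∀ l : L, #{p : P | G.incid p l} = s + 1)
    (hpoint : ∀ p : P, #{l : L | G.incid p l} = t + 1) {x y : P} (hxy : ¬ G.Collin x y) :
    #{z : P | ¬ G.Collin x z ∧ ¬ G.Collin y z} + s * (t + 1) = s ^ 2 * t + t := by
  have h1 := card_filter_add_card_filter_not (s := ({z : P | ¬ G.Collin x z} : Finset P))
    (fun z => G.Collin y z)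
  have h2 := card_filter_add_card_filter_not (s := ({z : P | G.Collin y z} : Finset P))
    (fun z => G.Collin x z)
  rw [G.card_not_collin hline hpoint] at h1
  rw [G.card_collin hline hpoint] at h2
  have h3 := G.card_common hpoint hxy
  simp only [filter_filter] at h1 h2
  simp only [and_comm (a := G.Collin y _)] at h2
  omega

/-- A common neighbour `u` of noncollinear `x`, `y` is collinear with `s * (t - 1)` points
that are collinear with neither `x` nor `y`. -/
theorem card_collin_not_collin_both (hline : ∀ l : L, #{p : P | G.incid p l} = s + 1)
    (hpoint : ∀ p : P, #{l : L | G.incid p l} = t + 1) {x y u : P}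
    (hxy : ¬ G.Collin x y) (hxu : G.Collin x u) (hyu : G.Collin y u) :
    #{z : P | (¬ G.Collin x z ∧ ¬ G.Collin y z) ∧ G.Collin u z} = s * (t - 1) := by
  have hux : u ≠ x := by
    rintro rfl
    exact hxy (collin_symm hyu)
  have huy : u ≠ y := by
    rintro rfl
    exact hxy hxu
  obtain ⟨m, hxm, hum⟩ := hxu
  obtain ⟨n, hyn, hun⟩ := hyu
  have hmn : n ≠ m := by
    rintro rfl
    exact hxy ⟨n, hxm, hyn⟩
  have h := G.card_points_on hline u ((({l : L | G.incid u l} : Finset L).erase m).erase n)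
    (by simp)
  rw [card_erase_of_mem (by simpa [hmn] using hun), card_erase_of_mem (by simpa using hum),
    hpoint, Nat.add_sub_cancel] at h
  rw [← h]
  congr 1
  ext z
  simp only [mem_filter, mem_univ, true_and, mem_erase]
  constructor
  · rintro ⟨⟨hxz, hyz⟩, l, hul, hzl⟩
    refine ⟨?_, l, ⟨?_, ?_, hul⟩, hzl⟩
    · rintro rfl
      exact hxz ⟨m, hxm, hum⟩
    · rintro rfl
      exact hyz ⟨l, hyn, hzl⟩
    · rintro rfl
      exact hxz ⟨l, hxm, hzl⟩
  · rintro ⟨hzu, l, ⟨hln, hlm, hul⟩, hzl⟩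
    refine ⟨⟨fun hxz => hzu ?_, fun hyz => hzu ?_⟩, l, hul, hzl⟩
    · refine G.eq_of_collin_of_not_incid (fun hxl => hlm ?_) hzl hul hxz ⟨m, hxm, hum⟩
      exact G.unique_line hux hul hxl hum hxm
    · refine G.eq_of_collin_of_not_incid (fun hyl => hln ?_) hzl hul hyz ⟨n, hyn, hun⟩
      exact G.unique_line huy hul hyl hun hyn

/-- Distinct common neighbours `u`, `v` of noncollinear `x`, `y` have `t - 1` common
neighbours that are collinear with neither `x` nor `y`. -/
theorem card_common_not_collin_both (hpoint : ∀ p : P, #{l : L | G.incid p l} = t + 1)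
    {x y u v : P} (hxy : ¬ G.Collin x y) (huv : u ≠ v)
    (hxu : G.Collin x u) (hyu : G.Collin y u) (hxv : G.Collin x v) (hyv : G.Collin y v) :
    #{z : P | (¬ G.Collin x z ∧ ¬ G.Collin y z) ∧ G.Collin u z ∧ G.Collin v z} = t - 1 := by
  have hnuv := G.not_collin_of_common hxy huv hxu hxv hyu hyv
  have h := G.card_common hpoint hnuv
  have hyx : y ≠ x := by
    rintro rfl
    exact hxy (G.collin_self hpoint y)
  have hux := collin_symm hxu
  have huy := collin_symm hyu
  have hvx := collin_symm hxv
  have hvy := collin_symm hyv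
  have key : ({z : P | (¬ G.Collin x z ∧ ¬ G.Collin y z) ∧ G.Collin u z ∧ G.Collin v z} :
      Finset P) = (({z : P | G.Collin u z ∧ G.Collin v z} : Finset P).erase x).erase y := by
    ext z
    simp only [mem_filter, mem_univ, true_and, mem_erase]
    constructor
    · rintro ⟨⟨hxz, hyz⟩, huz, hvz⟩
      refine ⟨?_, ?_, huz, hvz⟩
      · rintro rfl
        exact hyz (G.collin_self hpoint z)
      · rintro rfl
        exact hxz (G.collin_self hpoint z)
    · rintro ⟨hzy, hzx, huz, hvz⟩
      exact ⟨⟨G.not_collin_of_common hnuv hzx.symm hux huz hvx hvz,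
        G.not_collin_of_common hnuv hzy.symm huy huz hvy hvz⟩, huz, hvz⟩
  rw [key, card_erase_of_mem (by simp [hyx, huy, hvy]),
    card_erase_of_mem (by simp [hux, hvx]), h, Nat.add_sub_cancel]

/-- One half of Higman's inequality; the other half follows by duality. -/
theorem t_le_sq (hline : ∀ l : L, #{p : P | G.incid p l} = s + 1)
    (hpoint : ∀ p : P, #{l : L | G.incid p l} = t + 1) [Nonempty P]
    (hs : 1 < s) (ht : 1 < t) : t ≤ s ^ 2 := by
  obtain ⟨x⟩ := ‹Nonempty P›
  obtain ⟨y, hy⟩ : ({z : P | ¬ G.Collin x z} : Finset P).Nonempty := by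
    rw [← card_pos, G.card_not_collin hline hpoint]
    positivity
  have hxy : ¬ G.Collin x y := by simpa using hy
  set T : Finset P := {u : P | G.Collin x u ∧ G.Collin y u} with hT
  set V : Finset P := {z : P | ¬ G.Collin x z ∧ ¬ G.Collin y z} with hV
  have hTcard : #T = t + 1 := G.card_common hpoint hxy
  have hVcard : #V + s * (t + 1) = s ^ 2 * t + t := G.card_not_collin_both hline hpoint hxy
  have hone : ∀ u ∈ T, #{z ∈ V | G.Collin u z} = s * (t - 1) := by
    intro u hu
    simp only [hT, mem_filter, mem_univ, true_and] at hu
    rw [hV, filter_filter]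
    exact G.card_collin_not_collin_both hline hpoint hxy hu.1 hu.2
  have htwo : ∀ u ∈ T, ∀ v ∈ T, u ≠ v →
      #{z ∈ V | G.Collin u z ∧ G.Collin v z} = t - 1 := by
    intro u hu v hv huv
    simp only [hT, mem_filter, mem_univ, true_and] at hu hv
    rw [hV, filter_filter]
    exact G.card_common_not_collin_both hpoint hxy huv hu.1 hu.2 hv.1 hv.2
  have hsum : ∑ z ∈ V, #{u ∈ T | G.Collin u z} = (t + 1) * (s * (t - 1)) := by
    rw [← hTcard, ← smul_eq_mul, ← sum_const, ← sum_congr rfl hone]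
    exact (sum_card_bipartiteAbove_eq_sum_card_bipartiteBelow G.Collin).symm
  have hsq : ∑ z ∈ V, #{u ∈ T | G.Collin u z} ^ 2 =
      (t + 1) * (s * (t - 1) + t * (t - 1)) := by
    calc ∑ z ∈ V, #{u ∈ T | G.Collin u z} ^ 2
        = ∑ z ∈ V, ∑ u ∈ T, ∑ v ∈ T, if G.Collin u z ∧ G.Collin v z then 1 else 0 := by
          refine sum_congr rfl fun z _ => ?_
          rw [sq, card_filter, sum_mul_sum]
          refine sum_congr rfl fun u _ => sum_congr rfl fun v _ => ?_
          rw [ite_and, ite_mul, one_mul, zero_mul]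
      _ = ∑ u ∈ T, ∑ v ∈ T, #{z ∈ V | G.Collin u z ∧ G.Collin v z} := by
          rw [sum_comm]
          refine sum_congr rfl fun u _ => ?_
          rw [sum_comm]
          refine sum_congr rfl fun v _ => ?_
          rw [card_filter]
      _ = ∑ u ∈ T, (s * (t - 1) + t * (t - 1)) := by
          refine sum_congr rfl fun u hu => ?_
          rw [← add_sum_erase T _ hu]
          congr 1
          · simpa using hone u hu
          · rw [sum_congr rfl (g := fun _ => t - 1), sum_const, card_erase_of_mem hu, hTcard,
              Nat.add_sub_cancel, smul_eq_mul]
            intro v hv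
            rw [mem_erase] at hv
            exact htwo u hu v hv.2 hv.1.symm
      _ = _ := by rw [sum_const, hTcard, smul_eq_mul]
  have hcs := sq_sum_le_card_mul_sum_sq (s := V) (f := fun z => #{u ∈ T | G.Collin u z})
  rw [hsum, hsq] at hcs
  obtain ⟨r, rfl⟩ : ∃ r, t = r + 1 := ⟨t - 1, by omega⟩
  rw [Nat.add_sub_cancel] at hcs
  zify at hcs hVcard hs ht ⊢
  have hVeq : (#V : ℤ) = s ^ 2 * (r + 1) + (r + 1) - s * (r + 1 + 1) := by linarith
  rw [hVeq] at hcs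
  by_contra! hlt
  have hpos : 0 < ((r : ℤ) + 2) * r * ((r + 1) * (s - 1) * ((r + 1) - s ^ 2)) := by
    have h1 : (0 : ℤ) < r := by linarith
    have h2 : (0 : ℤ) < s - 1 := by linarith
    have h3 : (0 : ℤ) < (r + 1) - s ^ 2 := by linarith
    positivity
  nlinarith [hcs, hpos]

end Counting

end GenQuad

/-- Higman's inequality: in a finite generalised quadrangle of order `(s,t)`
with `s > 1` and `t > 1`, we have `s ≤ t²` and `t ≤ s²`. -/
theorem gq_higman {P L : Type*} [Finite P] [Finite L]
    [Nonempty P] [Nonempty L]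
    (G : GenQuad P L) (s t : ℕ)
    (hline : ∀ l : L, Nat.card {p : P // G.incid p l} = s + 1)
    (hpoint : ∀ p : P, Nat.card {l : L // G.incid p l} = t + 1)
    (hs : 1 < s) (ht : 1 < t) :
    s ≤ t ^ 2 ∧ t ≤ s ^ 2 := by
  classical
  have := Fintype.ofFinite P
  have := Fintype.ofFinite L
  simp only [Nat.card_eq_fintype_card, Fintype.card_subtype] at hline hpoint
  exact ⟨G.dual.t_le_sq (fun p => by convert hpoint p; rfl) (fun l => by convert hline l; rfl) ht hs,
    G.t_le_sq (fun l => by convert hline l) (fun p => by convert hpoint p) hs ht⟩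
end

section
/- Let x and y be non-collinear points in a finite generalised quadrangle of order (s,t), and let a ∈ sp(x,y) with a ≠ x and a non-collinear with x. Then sp(a,x) = sp(x,y). -/
/-- `B₁(x,y)`: the set of points collinear with both `x` and `y`. -/
def GenQuad.B1pair {P L : Type*} (G : GenQuad P L) (x y : P) : Set P :=
  {z : P | G.Collin z x ∧ G.Collin z y}

/-- The span (hyperbolic line) `sp(x,y) = B₁(B₁(x,y))`: the set of points
collinear with every point of `B₁(x,y)`. -/
def GenQuad.spanPair {P L : Type*} (G : GenQuad P L) (x y : P) : Set P :=
  {z : P | ∀ w ∈ G.B1pair x y, G.Collin z w}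

/-- In a finite generalised quadrangle of order `(s,t)`, if `x`, `y` are
non-collinear and `a ∈ sp(x,y)` with `a ≠ x` and `a` non-collinear with `x`,
then `sp(a,x) = sp(x,y)`. -/
theorem gq_span_eq {P L : Type*} [Finite P] [Finite L]
    (G : GenQuad P L) (s t : ℕ)
    (hline : ∀ l : L, Nat.card {p : P // G.incid p l} = s + 1)
    (hpoint : ∀ p : P, Nat.card {l : L // G.incid p l} = t + 1)
    (x y : P) (hxy : ¬ G.Collin x y)
    (a : P) (ha : a ∈ G.spanPair x y) (hax : a ≠ x) (hacol : ¬ G.Collin a x) :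
    G.spanPair a x = G.spanPair x y := by
  suffices h : G.B1pair a x = G.B1pair x y by
    simp only [GenQuad.spanPair, h]
  ext w
  constructor
  · rintro ⟨⟨m, hwm, ham⟩, l, hwl, hxl⟩
    have hyl : ¬ G.incid y l := fun hyl => hxy ⟨l, hxl, hyl⟩
    have hal : ¬ G.incid a l := fun hal => hacol ⟨l, hal, hxl⟩
    obtain ⟨z, ⟨hzl, n, hyn, hzn⟩, -⟩ := G.gq y l hyl
    have hz : z ∈ G.B1pair x y := ⟨⟨l, hzl, hxl⟩, n, hzn, hyn⟩
    have hwz : w = z := (G.gq a l hal).unique ⟨hwl, m, ham, hwm⟩ ⟨hzl, ha z hz⟩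
    exact hwz ▸ hz
  · intro hw
    obtain ⟨l, hal, hwl⟩ := ha w hw
    exact ⟨⟨l, hwl, hal⟩, hw.1⟩
end
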